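/- arXiv:math/0405383 — 2 statements merged into one kernel-verified Lean document; each statement's English description precedes it below -/
import Mathlib

section
/- Suppose k_j = k_{j'} whenever j ≡ j' + 2 (mod d), and define H : ℂ[Z,W] → ℂ[Z,W] by H(f) = Z·D_Z(f) + W·D_W(f) + f − Σ_{j=1}^d k_j·σ_j(f). Then for every f ∈ ℂ[Z,W]: H(Z·f) − Z·H(f) = Z·f, H(W·f) − W·H(f) = W·f, H(D_Z(f)) − D_Z(H(f)) = −D_Z(f), and H(D_W(f)) − D_W(H(f)) = −D_W(f). -/
open MvPolynomial
open scoped Classical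

noncomputable section

/-- The polynomial ring `ℂ[Z,W]`, with `Z = X 0` and `W = X 1`. -/
abbrev R2 : Type := MvPolynomial (Fin 2) ℂ

/-- `ζ = exp(2πi/d)`. -/
def zeta (d : ℕ) : ℂ := Complex.exp (2 * Real.pi * Complex.I / d)

/-- The action of the reflection `s_j` of `I₂(d)` on `ℂ[Z,W]`:
`Z ↦ ζ^j·W`, `W ↦ ζ^{-j}·Z`. -/
def reflAct (d j : ℕ) : R2 →ₐ[ℂ] R2 :=
  aeval ![C (zeta d ^ j) * X 1, C ((zeta d ^ j)⁻¹) * X 0]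

/-- Exact division: if `a ∣ b` in `ℂ[Z,W]` this is the (unique, when `a ≠ 0`)
quotient, and `0` otherwise. -/
def exQuot (a b : R2) : R2 := if h : ∃ c, b = a * c then Classical.choose h else 0

/-- The Dunkl operator `D_Z` with parameters `k₁,…,k_d`. -/
def DZ (d : ℕ) (k : ℕ → ℂ) (f : R2) : R2 :=
  pderiv (0 : Fin 2) f - ∑ j ∈ Finset.Icc 1 d,
    C (k j) * exQuot (X 0 - C (zeta d ^ j) * X 1) (f - reflAct d j f)

/-- The Dunkl operator `D_W` with parameters `k₁,…,k_d`. -/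
def DW (d : ℕ) (k : ℕ → ℂ) (f : R2) : R2 :=
  pderiv (1 : Fin 2) f - ∑ j ∈ Finset.Icc 1 d,
    C (k j) * exQuot (X 1 - C ((zeta d ^ j)⁻¹) * X 0) (f - reflAct d j f)

theorem exQuot_mul {a : R2} (ha : a ≠ 0) (c : R2) : exQuot a (a * c) = c := by
  have h : ∃ c', a * c = a * c' := ⟨c, rfl⟩
  rw [exQuot, dif_pos h]
  exact (mul_left_cancel₀ ha (Classical.choose_spec h)).symm

theorem mul_exQuot {a b : R2} (h : a ∣ b) : a * exQuot a b = b := by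
  have h' : ∃ c, b = a * c := h
  rw [exQuot, dif_pos h']
  exact (Classical.choose_spec h').symm

theorem exQuot_eq_of_mul_eq {a b c : R2} (ha : a ≠ 0) (h : a * c = b) : exQuot a b = c := by
  rw [← h, exQuot_mul ha]

theorem zeta_pow_ne_zero (d j : ℕ) : zeta d ^ j ≠ 0 :=
  pow_ne_zero _ (Complex.exp_ne_zero _)

@[simp]
theorem reflAct_X_zero (d j : ℕ) : reflAct d j (X 0) = C (zeta d ^ j) * X 1 := by
  simp [reflAct]

@[simp]
theorem reflAct_X_one (d j : ℕ) : reflAct d j (X 1) = C ((zeta d ^ j)⁻¹) * X 0 := by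
  simp [reflAct]

@[simp]
theorem reflAct_C (d j : ℕ) (c : ℂ) : reflAct d j (C c) = C c :=
  (reflAct d j).commutes c

theorem C_zeta_mul_C_inv (d j : ℕ) : (C (zeta d ^ j) * C (zeta d ^ j)⁻¹ : R2) = 1 := by
  rw [← C_mul, mul_inv_cancel₀ (zeta_pow_ne_zero d j), C_1]

/-- An element dividing `x - φ x` for both variables `x` divides `f - φ f` for all `f`. -/
theorem dvd_sub_algHom {L : R2} {φ : R2 →ₐ[ℂ] R2} (h : ∀ i, L ∣ X i - φ (X i)) (f : R2) :
    L ∣ f - φ f := by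
  induction f using MvPolynomial.induction_on with
  | C c =>
    have hc : φ (C c) = C c := φ.commutes c
    simp [hc]
  | add p q hp hq =>
    rw [map_add, add_sub_add_comm]
    exact dvd_add hp hq
  | mul_X p i hp =>
    have : p * X i - φ (p * X i) = (p - φ p) * X i + φ p * (X i - φ (X i)) := by
      rw [map_mul]; ring
    rw [this]
    exact dvd_add (hp.mul_right _) ((h i).mul_left _)

theorem root_Z_dvd (d j : ℕ) (f : R2) :
    X 0 - C (zeta d ^ j) * X 1 ∣ f - reflAct d j f := by
  refine dvd_sub_algHom (fun i => ?_) f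
  fin_cases i
  · simp
  · refine ⟨-C (zeta d ^ j)⁻¹, ?_⟩
    simp only [Fin.mk_one, reflAct_X_one]
    linear_combination (-X 1 : R2) * C_zeta_mul_C_inv d j

theorem root_W_eq (d j : ℕ) :
    (X 1 - C (zeta d ^ j)⁻¹ * X 0 : R2) =
      -C (zeta d ^ j)⁻¹ * (X 0 - C (zeta d ^ j) * X 1) := by
  linear_combination (-X 1 : R2) * C_zeta_mul_C_inv d j

theorem root_W_dvd (d j : ℕ) (f : R2) :
    X 1 - C (zeta d ^ j)⁻¹ * X 0 ∣ f - reflAct d j f := by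
  refine dvd_trans ⟨-C (zeta d ^ j), ?_⟩ (root_Z_dvd d j f)
  linear_combination (-X 0 : R2) * C_zeta_mul_C_inv d j

theorem root_Z_ne_zero (d j : ℕ) : (X 0 - C (zeta d ^ j) * X 1 : R2) ≠ 0 := by
  intro h
  simpa using congrArg (eval ![1, 0]) h

theorem root_W_ne_zero (d j : ℕ) : (X 1 - C (zeta d ^ j)⁻¹ * X 0 : R2) ≠ 0 := by
  intro h
  simpa using congrArg (eval ![0, 1]) h

/-- The Euler derivation `Z ∂_Z + W ∂_W`. -/
def euler : Derivation ℂ R2 R2 := (X 0 : R2) • pderiv 0 + (X 1 : R2) • pderiv 1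

theorem euler_apply (f : R2) : euler f = X 0 * pderiv 0 f + X 1 * pderiv 1 f := rfl

@[simp]
theorem euler_X (i : Fin 2) : euler (X i) = X i := by
  fin_cases i <;> simp [euler_apply]

@[simp]
theorem euler_C (c : ℂ) : euler (C c) = 0 := euler.map_algebraMap c

theorem euler_C_mul (c : ℂ) (f : R2) : euler (C c * f) = C c * euler f := by
  simp [euler.leibniz]

theorem euler_reflAct (d j : ℕ) (f : R2) : euler (reflAct d j f) = reflAct d j (euler f) := by
  induction f using MvPolynomial.induction_on with
  | C c => simp
  | add p q hp hq => simp only [map_add, hp, hq]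
  | mul_X p i hp =>
    have hX : euler (reflAct d j (X i)) = reflAct d j (X i) := by
      fin_cases i <;> simp
    simp only [map_mul, euler.leibniz, smul_eq_mul, map_add, hp, hX, euler_X]

theorem pderiv_euler (i : Fin 2) (f : R2) :
    pderiv i (euler f) = euler (pderiv i f) + pderiv i f := by
  induction f using MvPolynomial.induction_on with
  | C c => simp
  | add p q hp hq => simp only [map_add, hp, hq]; ring
  | mul_X p l hp =>
    have hX : euler (pderiv i (X l : R2)) = 0 := by
      rw [pderiv_X]
      by_cases h : i = l
      · subst h; simp
      · simp [Pi.single_eq_of_ne (Ne.symm h)]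
    simp only [euler.leibniz, (pderiv i).leibniz, smul_eq_mul, map_add, hp, hX, euler_X]
    ring

/-- Commutation of an operator of Dunkl type, whose denominators are linear forms, with the Euler
derivation shifted by a constant. -/
theorem dunkl_euler_add (d : ℕ) (k : ℕ → ℂ) (i : Fin 2) (L : ℕ → R2) (hL : ∀ j, L j ≠ 0)
    (hE : ∀ j, euler (L j) = L j) (hdvd : ∀ j f, L j ∣ f - reflAct d j f)
    (T : R2 → R2)
    (hT : ∀ f, T f = pderiv i f - ∑ j ∈ Finset.Icc 1 d,
      C (k j) * exQuot (L j) (f - reflAct d j f))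
    (c : ℂ) (f : R2) :
    T (euler f + C c * f) = euler (T f) + T f + C c * T f := by
  have hq : ∀ j, exQuot (L j) (euler f + C c * f - reflAct d j (euler f + C c * f)) =
      euler (exQuot (L j) (f - reflAct d j f)) + exQuot (L j) (f - reflAct d j f)
        + C c * exQuot (L j) (f - reflAct d j f) := by
    intro j
    refine exQuot_eq_of_mul_eq (hL j) ?_
    have h := mul_exQuot (hdvd j f)
    have h' := congrArg euler h
    rw [euler.leibniz, map_sub, hE, euler_reflAct, smul_eq_mul, smul_eq_mul] at h'
    rw [map_add, map_mul, reflAct_C]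
    linear_combination h' + C c * h
  simp only [hT, hq]
  simp only [map_add, map_sub, map_sum, pderiv_euler, pderiv_C_mul, euler_C_mul, mul_add, mul_sub,
    Finset.sum_add_distrib, Finset.mul_sum, mul_left_comm (C c)]
  ring

theorem X_mul_DZ_add_X_mul_DW (d : ℕ) (k : ℕ → ℂ) (f : R2) :
    X 0 * DZ d k f + X 1 * DW d k f =
      euler f - ∑ j ∈ Finset.Icc 1 d, C (k j) * (f - reflAct d j f) := by
  have hq : ∀ j, C (k j) * (f - reflAct d j f) =
      X 0 * (C (k j) * exQuot (X 0 - C (zeta d ^ j) * X 1) (f - reflAct d j f)) +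
      X 1 * (C (k j) * exQuot (X 1 - C (zeta d ^ j)⁻¹ * X 0) (f - reflAct d j f)) := by
    intro j
    have hZ := mul_exQuot (root_Z_dvd d j f)
    have hW : exQuot (X 1 - C (zeta d ^ j)⁻¹ * X 0) (f - reflAct d j f) =
        -C (zeta d ^ j) * exQuot (X 0 - C (zeta d ^ j) * X 1) (f - reflAct d j f) := by
      refine exQuot_eq_of_mul_eq (root_W_ne_zero d j) ?_
      rw [root_W_eq]
      linear_combination (f - reflAct d j f) * C_zeta_mul_C_inv d j
        + C (zeta d ^ j) * C (zeta d ^ j)⁻¹ * hZ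
    rw [hW]
    linear_combination -C (k j) * hZ
  simp only [hq, DZ, DW, euler_apply, mul_sub, Finset.mul_sum, Finset.sum_add_distrib]
  ring

/-- With conjugation-invariant parameters, the grading operator `H` satisfies
`[H, Z·] = Z·`, `[H, W·] = W·`, `[H, D_Z] = −D_Z`, `[H, D_W] = −D_W`. -/
theorem h_grading (d : ℕ) (hd : 3 ≤ d) (k : ℕ → ℂ)
    (hk : ∀ j j', j ∈ Finset.Icc 1 d → j' ∈ Finset.Icc 1 d →
      (j : ZMod d) = (j' : ZMod d) + 2 → k j = k j')
    (H : R2 → R2)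
    (hH : ∀ f, H f = X 0 * DZ d k f + X 1 * DW d k f + f
        - ∑ j ∈ Finset.Icc 1 d, C (k j) * reflAct d j f)
    (f : R2) :
    H (X 0 * f) - X 0 * H f = X 0 * f ∧
    H (X 1 * f) - X 1 * H f = X 1 * f ∧
    H (DZ d k f) - DZ d k (H f) = -(DZ d k f) ∧
    H (DW d k f) - DW d k (H f) = -(DW d k f) := by
  have hH' : ∀ g, H g = euler g + C (1 - ∑ j ∈ Finset.Icc 1 d, k j) * g := by
    intro g
    rw [hH, X_mul_DZ_add_X_mul_DW]
    simp only [mul_sub, Finset.sum_sub_distrib, C_sub, C_1, map_sum, sub_mul, Finset.sum_mul]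
    ring
  refine ⟨?_, ?_, ?_, ?_⟩
  · rw [hH', hH', euler.leibniz, euler_X, smul_eq_mul, smul_eq_mul]
    ring
  · rw [hH', hH', euler.leibniz, euler_X, smul_eq_mul, smul_eq_mul]
    ring
  · rw [hH', hH', dunkl_euler_add d k 0 _ (root_Z_ne_zero d)
      (fun j => by simp) (root_Z_dvd d) (DZ d k) (fun _ => rfl)]
    ring
  · rw [hH', hH', dunkl_euler_add d k 1 _ (root_W_ne_zero d)
      (fun j => by simp) (root_W_dvd d) (DW d k) (fun _ => rfl)]
    ring

end
end

section
/- Let d = 2m be even with m ≥ 2, and let k_j = k₁ for odd j and k_j = k₂ for even j. For every integer i ≥ 0 and every value of k₂ ∈ ℂ, the polynomial f = (Z^m + W^m)^{2i+1} is singular (i.e. D_Z(f) = 0 and D_W(f) = 0) if and only if k₁ = i + 1/2. -/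
open MvPolynomial
open scoped Classical

noncomputable section

/-- Exact division by a nonzero polynomial recovers the cofactor. -/
lemma exQuot_eq_of_eq_mul {a b c : R2} (ha : a ≠ 0) (h : b = a * c) : exQuot a b = c := by
  have hex : ∃ c, b = a * c := ⟨c, h⟩
  rw [exQuot, dif_pos hex]
  exact mul_left_cancel₀ ha ((Classical.choose_spec hex).symm.trans h)

lemma exQuot_zero_right {a : R2} (ha : a ≠ 0) : exQuot a 0 = 0 :=
  exQuot_eq_of_eq_mul ha (mul_zero a).symm

lemma X_sub_C_mul_X_ne_zero {p q : Fin 2} (hpq : p ≠ q) (a : ℂ) :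
    (X p - C a * X q : R2) ≠ 0 := by
  intro h
  have := congrArg (eval (Pi.single p (1 : ℂ))) h
  simp [Pi.single_eq_of_ne hpq.symm] at this

lemma isPrimitiveRoot_zeta {d : ℕ} (hd : d ≠ 0) : IsPrimitiveRoot (zeta d) d :=
  Complex.isPrimitiveRoot_exp d hd

lemma IsPrimitiveRoot.pow_half_eq_neg_one {m : ℕ} (hm : m ≠ 0) {x : ℂ}
    (hx : IsPrimitiveRoot x (2 * m)) : x ^ m = -1 :=
  (hx.pow (by positivity) (mul_comm 2 m)).eq_neg_one_of_two_right

/-- The power sums of exponent `0 < n < m` of the `m`-th roots of `-1` vanish. -/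
lemma IsPrimitiveRoot.sum_odd_pow_eq_zero {m n : ℕ} (hn : n ≠ 0) (hnm : n < m) {x : ℂ}
    (hx : IsPrimitiveRoot x (2 * m)) :
    ∑ t ∈ Finset.range m, (x ^ (2 * t + 1)) ^ n = 0 := by
  have hne : x ^ (2 * n) ≠ 1 := hx.pow_ne_one_of_pos_of_lt (by omega) (by omega)
  have hpow : (x ^ (2 * n)) ^ m = 1 := by
    rw [← pow_mul, show 2 * n * m = 2 * m * n by ring, pow_mul, hx.pow_eq_one, one_pow]
  have hgeom : ∑ t ∈ Finset.range m, (x ^ (2 * n)) ^ t = 0 := by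
    rw [geom_sum_eq hne, hpow, sub_self, zero_div]
  calc ∑ t ∈ Finset.range m, (x ^ (2 * t + 1)) ^ n
      = ∑ t ∈ Finset.range m, x ^ n * (x ^ (2 * n)) ^ t :=
        Finset.sum_congr rfl fun t _ => by ring
    _ = 0 := by rw [← Finset.mul_sum, hgeom, mul_zero]

/-- The partial fraction identity `∑ (u^m + v^m) / (u - a v) = m u^(m-1)`, the sum being over
the `m`-th roots `a` of `-1`, with each quotient written as a geometric sum. -/
lemma sum_geom_sum_odd_pow {m : ℕ} (hm : m ≠ 0) {x : ℂ} (hx : IsPrimitiveRoot x (2 * m))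
    (u v : R2) :
    ∑ t ∈ Finset.range m, ∑ l ∈ Finset.range m,
      u ^ l * (C (x ^ (2 * t + 1)) * v) ^ (m - 1 - l) = m * u ^ (m - 1) := by
  rw [Finset.sum_comm, Finset.sum_eq_single_of_mem (m - 1) (Finset.mem_range.2 (by omega))]
  · simp
  · intro l hl hne
    have hl := Finset.mem_range.1 hl
    have h := hx.sum_odd_pow_eq_zero (n := m - 1 - l) (by omega) (by omega)
    calc ∑ t ∈ Finset.range m, u ^ l * (C (x ^ (2 * t + 1)) * v) ^ (m - 1 - l)
        = C (∑ t ∈ Finset.range m, (x ^ (2 * t + 1)) ^ (m - 1 - l)) *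
            (u ^ l * v ^ (m - 1 - l)) := by
          rw [map_sum, Finset.sum_mul]
          refine Finset.sum_congr rfl fun t _ => ?_
          rw [mul_pow, ← C_pow]
          exact mul_left_comm _ _ _
      _ = 0 := by rw [h, C_0, zero_mul]

lemma sum_exQuot_odd {m : ℕ} (hm : m ≠ 0) {x : ℂ} (hx : IsPrimitiveRoot x (2 * m))
    {p q : Fin 2} (hpq : p ≠ q) (i : ℕ) :
    ∑ t ∈ Finset.range m, exQuot (X p - C (x ^ (2 * t + 1)) * X q)
      (2 * ((X p : R2) ^ m + X q ^ m) ^ (2 * i + 1)) =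
      2 * (m : R2) * X p ^ (m - 1) * (X p ^ m + X q ^ m) ^ (2 * i) := by
  have hquot : ∀ t ∈ Finset.range m, exQuot (X p - C (x ^ (2 * t + 1)) * X q)
      (2 * ((X p : R2) ^ m + X q ^ m) ^ (2 * i + 1)) =
      2 * (X p ^ m + X q ^ m) ^ (2 * i) * ∑ l ∈ Finset.range m,
        X p ^ l * (C (x ^ (2 * t + 1)) * X q) ^ (m - 1 - l) := by
    intro t _
    refine exQuot_eq_of_eq_mul (X_sub_C_mul_X_ne_zero hpq _) ?_
    have ha : (x ^ (2 * t + 1)) ^ m = -1 := by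
      rw [pow_right_comm, hx.pow_half_eq_neg_one hm, pow_succ, pow_mul]
      simp
    have hgeom := (Commute.all (X p : R2) (C (x ^ (2 * t + 1)) * X q)).mul_geom_sum₂ m
    rw [mul_pow, ← C_pow, ha, C_neg, C_1] at hgeom
    linear_combination (-2 * ((X p : R2) ^ m + X q ^ m) ^ (2 * i)) * hgeom
  rw [Finset.sum_congr rfl hquot, ← Finset.mul_sum, sum_geom_sum_odd_pow hm hx]
  ring

lemma Finset.sum_Icc_one_two_mul {M : Type*} [AddCommMonoid M] (g : ℕ → M) (m : ℕ) :
    ∑ j ∈ Finset.Icc 1 (2 * m), g j =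
      ∑ t ∈ Finset.range m, (g (2 * t + 1) + g (2 * t + 2)) := by
  induction m with
  | zero => simp
  | succ n ih =>
    rw [Finset.sum_range_succ, ← ih, show 2 * (n + 1) = 2 * n + 1 + 1 by ring,
      Finset.sum_Icc_succ_top (by omega), Finset.sum_Icc_succ_top (by omega), add_assoc]

lemma reflAct_pow_add_pow {m : ℕ} (hm : m ≠ 0) (j : ℕ) :
    reflAct (2 * m) j ((X 0 : R2) ^ m + X 1 ^ m) = C ((-1) ^ j) * (X 0 ^ m + X 1 ^ m) := by
  have hz : (zeta (2 * m) ^ j) ^ m = (-1) ^ j := by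
    rw [pow_right_comm, (isPrimitiveRoot_zeta (by omega)).pow_half_eq_neg_one hm]
  have hinv : (((-1 : ℂ)) ^ j)⁻¹ = (-1) ^ j := by rw [← inv_pow, inv_neg_one]
  simp only [reflAct, map_add, map_pow, aeval_X, Matrix.cons_val_zero, Matrix.cons_val_one,
    mul_pow]
  rw [← C_pow, ← C_pow, ← C_pow, hz, inv_pow, hz, hinv, C_pow]
  ring

/-- The reflection part of either Dunkl operator on `(Z^m + W^m)^(2i+1)`: only the odd
reflections contribute. -/
lemma sum_reflection_part {m : ℕ} (hm : m ≠ 0) {x : ℂ} (hx : IsPrimitiveRoot x (2 * m))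
    {p q : Fin 2} (hpq : p ≠ q) (i : ℕ) (k₁ k₂ : ℂ) {f : R2}
    (hf : f = ((X 0 : R2) ^ m + X 1 ^ m) ^ (2 * i + 1))
    (hf' : f = ((X p : R2) ^ m + X q ^ m) ^ (2 * i + 1)) :
    ∑ j ∈ Finset.Icc 1 (2 * m), C (if j % 2 = 1 then k₁ else k₂) *
      exQuot (X p - C (x ^ j) * X q) (f - reflAct (2 * m) j f) =
      C k₁ * (2 * (m : R2) * X p ^ (m - 1) * (X p ^ m + X q ^ m) ^ (2 * i)) := by
  have hodd : ∀ t, f - reflAct (2 * m) (2 * t + 1) f = 2 * f := by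
    intro t
    have hneg : (-1 : ℂ) ^ (2 * t + 1) = -1 := Odd.neg_one_pow ⟨t, rfl⟩
    rw [hf, map_pow, reflAct_pow_add_pow hm, hneg, C_neg, C_1, neg_one_mul,
      Odd.neg_pow ⟨i, rfl⟩]
    ring
  have heven : ∀ t, f - reflAct (2 * m) (2 * t + 2) f = 0 := by
    intro t
    have hone : (-1 : ℂ) ^ (2 * t + 2) = 1 := Even.neg_one_pow ⟨t + 1, by ring⟩
    rw [hf, map_pow, reflAct_pow_add_pow hm, hone, C_1, one_mul, sub_self]
  rw [Finset.sum_Icc_one_two_mul, ← sum_exQuot_odd hm hx hpq, Finset.mul_sum]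
  refine Finset.sum_congr rfl fun t _ => ?_
  rw [hodd, heven, exQuot_zero_right (X_sub_C_mul_X_ne_zero hpq _), mul_zero, add_zero,
    if_pos (by omega), hf']

lemma pderiv_sub_reflection_part {p q : Fin 2} (hpq : p ≠ q) (m i : ℕ) (k₁ : ℂ) :
    pderiv p (((X p : R2) ^ m + X q ^ m) ^ (2 * i + 1)) -
      C k₁ * (2 * (m : R2) * X p ^ (m - 1) * (X p ^ m + X q ^ m) ^ (2 * i)) =
    C (2 * ((i : ℂ) + 1 / 2 - k₁)) *
      ((m : R2) * X p ^ (m - 1) * (X p ^ m + X q ^ m) ^ (2 * i)) := by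
  have hC : (C (2 * ((i : ℂ) + 1 / 2 - k₁)) : R2) = 2 * (i : R2) + 1 - 2 * C k₁ := by
    rw [show 2 * ((i : ℂ) + 1 / 2 - k₁) = 2 * (i : ℂ) + 1 - 2 * k₁ by ring]
    simp [show (C 2 : R2) = 2 from rfl]
  rw [hC, Derivation.leibniz_pow, map_add, Derivation.leibniz_pow, Derivation.leibniz_pow,
    pderiv_X_self, pderiv_X_of_ne hpq.symm]
  simp only [smul_eq_mul, nsmul_eq_mul, Nat.add_sub_cancel, Nat.cast_add, Nat.cast_mul,
    Nat.cast_ofNat, Nat.cast_one]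
  ring

lemma DZ_pow_add_pow {m : ℕ} (hm : m ≠ 0) (i : ℕ) (k₁ k₂ : ℂ) :
    DZ (2 * m) (fun j => if j % 2 = 1 then k₁ else k₂)
      (((X 0 : R2) ^ m + X 1 ^ m) ^ (2 * i + 1)) =
      C (2 * ((i : ℂ) + 1 / 2 - k₁)) *
        ((m : R2) * X 0 ^ (m - 1) * (X 0 ^ m + X 1 ^ m) ^ (2 * i)) := by
  rw [DZ, sum_reflection_part hm (isPrimitiveRoot_zeta (by omega)) zero_ne_one i k₁ k₂ rfl rfl,
    pderiv_sub_reflection_part zero_ne_one]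

lemma DW_pow_add_pow {m : ℕ} (hm : m ≠ 0) (i : ℕ) (k₁ k₂ : ℂ) :
    DW (2 * m) (fun j => if j % 2 = 1 then k₁ else k₂)
      (((X 0 : R2) ^ m + X 1 ^ m) ^ (2 * i + 1)) =
      C (2 * ((i : ℂ) + 1 / 2 - k₁)) *
        ((m : R2) * X 1 ^ (m - 1) * (X 1 ^ m + X 0 ^ m) ^ (2 * i)) := by
  simp only [DW, ← inv_pow]
  rw [sum_reflection_part hm (isPrimitiveRoot_zeta (by omega)).inv one_ne_zero i k₁ k₂ rfl
    (by rw [add_comm]), add_comm (X 0 ^ m : R2), pderiv_sub_reflection_part one_ne_zero]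

/-- For even `d = 2m` with parameters `k₁` on odd reflections and `k₂` on even ones,
the polynomial `(Z^m + W^m)^{2i+1}` is singular iff `k₁ = i + 1/2` (for every `k₂`). -/
theorem even_plus_singular (m i : ℕ) (hm : 2 ≤ m) (k₁ k₂ : ℂ) (f : R2)
    (hf : f = ((X 0 : R2) ^ m + X 1 ^ m) ^ (2 * i + 1)) :
    (DZ (2 * m) (fun j => if j % 2 = 1 then k₁ else k₂) f = 0 ∧
     DW (2 * m) (fun j => if j % 2 = 1 then k₁ else k₂) f = 0) ↔
      k₁ = (i : ℂ) + 1 / 2 := by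
  have hm0 : m ≠ 0 := by omega
  rw [hf, DZ_pow_add_pow hm0, DW_pow_add_pow hm0]
  constructor
  · rintro ⟨hZ, -⟩
    have h := congrArg (eval fun _ => (1 : ℂ)) hZ
    simp only [map_mul, map_pow, map_add, map_natCast, map_zero, eval_C, eval_X, one_pow,
      mul_one, mul_eq_zero, Nat.cast_eq_zero, hm0, false_or] at h
    rcases h with h | h
    · linear_combination -h.resolve_left two_ne_zero
    · exact absurd h (pow_ne_zero _ (by norm_num))
  · rintro rfl
    simp

end
end
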